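/- (Key Euler-characteristic identities for the movable cone wall.) With e_α, e_γ, e_β the exceptional characters associated to (p−1)/2ⁿ, p/2ⁿ and (p+1)/2ⁿ respectively, let n₁, n₂ ∈ ℝ and set w := n₂·e_α − n₁·τ(e_β) and P := e_γ − (3·ch₀(e_β) − n₂)·e_α. Then: χ(e_γ, w) = 0; χ(e_β, P) = 0; χ(P, P) = 1 − n₂·(3·ch₀(e_β) − n₂); and χ(P, w − P) = −1. -/

import Mathlib

/-- The Euler pairing (Hirzebruch–Riemann–Roch on P²) on `K(P²)⊗ℝ ≅ ℝ³`,
identifying `v = (ch₀ v, ch₁ v, ch₂ v)`. -/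
noncomputable def chi (v w : ℝ × ℝ × ℝ) : ℝ :=
  v.2.2 * w.1 + w.2.2 * v.1 - v.2.1 * w.2.1 + (3 / 2) * (w.2.1 * v.1 - w.1 * v.2.1) + v.1 * w.1

/-- The Serre twist `τ(v)`, the Chern character of `V ⊗ O(−3)`. -/
noncomputable def tau (v : ℝ × ℝ × ℝ) : ℝ × ℝ × ℝ :=
  (v.1, v.2.1 - 3 * v.1, v.2.2 - 3 * v.2.1 + (9 / 2) * v.1)

/-- `vtil m p` is the exceptional character `ṽ(p / 2^m) ∈ ℝ³`, defined recursively: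
`ṽ(n) = (1, n, n²/2)` for integers `n`; for odd `p` and `m > 0`,
if `p ≡ 3 (mod 4)` then `ṽ(p/2^m) = 3·ch₀(ṽ((p+1)/2^m))·ṽ((p−1)/2^m) − ṽ((p−3)/2^m)`,
and if `p ≡ 1 (mod 4)` then `ṽ(p/2^m) = 3·ch₀(ṽ((p−1)/2^m))·ṽ((p+1)/2^m) − ṽ((p+3)/2^m)`.
For even `p` we reduce the fraction, so `vtil` is well defined on dyadic rationals
(each dyadic rational `q` is represented as `p / 2^m`). -/
noncomputable def vtil : ℕ → ℤ → ℝ × ℝ × ℝ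
  | 0, p => (1, (p : ℝ), (p : ℝ) ^ 2 / 2)
  | m + 1, p =>
    if p % 2 = 0 then vtil m (p / 2)
    else if p % 4 = 3 then
      (3 * (vtil m ((p + 1) / 2)).1) • vtil m ((p - 1) / 2) - vtil m ((p - 3) / 2)
    else
      (3 * (vtil m ((p - 1) / 2)).1) • vtil m ((p + 1) / 2) - vtil m ((p + 3) / 2)

theorem chi_sub_left (u v w : ℝ × ℝ × ℝ) : chi (u - v) w = chi u w - chi v w := by
  simp only [chi, Prod.fst_sub, Prod.snd_sub]; ring

theorem chi_sub_right (u v w : ℝ × ℝ × ℝ) : chi u (v - w) = chi u v - chi u w := by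
  simp only [chi, Prod.fst_sub, Prod.snd_sub]; ring

theorem chi_smul_left (r : ℝ) (v w : ℝ × ℝ × ℝ) : chi (r • v) w = r * chi v w := by
  simp only [chi, Prod.smul_fst, Prod.smul_snd, smul_eq_mul]; ring

theorem chi_smul_right (r : ℝ) (v w : ℝ × ℝ × ℝ) : chi v (r • w) = r * chi v w := by
  simp only [chi, Prod.smul_fst, Prod.smul_snd, smul_eq_mul]; ring

/-- Serre duality for the Euler pairing. -/
theorem chi_tau_right (v w : ℝ × ℝ × ℝ) : chi v (tau w) = chi w v := by
  simp only [chi, tau]; ring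

/-- The numerical properties of an exceptional triple `(a, c, b)` of characters on `P²`. -/
structure IsExceptionalTriple (a c b : ℝ × ℝ × ℝ) : Prop where
  chi_aa : chi a a = 1
  chi_cc : chi c c = 1
  chi_bb : chi b b = 1
  chi_ca : chi c a = 0
  chi_bc : chi b c = 0
  chi_ba : chi b a = 0
  chi_ac : chi a c = 3 * b.1
  chi_cb : chi c b = 3 * a.1
  chi_ab : chi a b = 9 * a.1 * b.1 - 3 * c.1

namespace IsExceptionalTriple

variable {a c b : ℝ × ℝ × ℝ}

/-- Mutation of an exceptional triple at the left end. -/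
theorem mutate_left (h : IsExceptionalTriple a c b) :
    IsExceptionalTriple a ((3 * a.1) • c - b) c := by
  obtain ⟨aa, cc, bb, ca, bc, ba, ac, cb, ab⟩ := h
  constructor <;>
    simp only [chi_sub_left, chi_sub_right, chi_smul_left, chi_smul_right, Prod.fst_sub,
      Prod.smul_fst, smul_eq_mul, aa, cc, bb, ca, bc, ba, ac, cb, ab] <;> ring

/-- Mutation of an exceptional triple at the right end. -/
theorem mutate_right (h : IsExceptionalTriple a c b) :
    IsExceptionalTriple c ((3 * b.1) • c - a) b := by
  obtain ⟨aa, cc, bb, ca, bc, ba, ac, cb, ab⟩ := h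
  constructor <;>
    simp only [chi_sub_left, chi_sub_right, chi_smul_left, chi_smul_right, Prod.fst_sub,
      Prod.smul_fst, smul_eq_mul, aa, cc, bb, ca, bc, ba, ac, cb, ab] <;> ring

end IsExceptionalTriple

theorem vtil_succ_two_mul (m : ℕ) (k : ℤ) : vtil (m + 1) (2 * k) = vtil m k := by
  rw [vtil, if_pos (by omega), show 2 * k / 2 = k by omega]

theorem vtil_succ_four_mul_add_one (m : ℕ) (j : ℤ) :
    vtil (m + 1) (4 * j + 1) =
      (3 * (vtil m (2 * j)).1) • vtil m (2 * j + 1) - vtil m (2 * j + 2) := by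
  rw [vtil, if_neg (by omega), if_neg (by omega), show (4 * j + 1 - 1) / 2 = 2 * j by omega,
    show (4 * j + 1 + 1) / 2 = 2 * j + 1 by omega, show (4 * j + 1 + 3) / 2 = 2 * j + 2 by omega]

theorem vtil_succ_four_mul_add_three (m : ℕ) (j : ℤ) :
    vtil (m + 1) (4 * j + 3) =
      (3 * (vtil m (2 * j + 2)).1) • vtil m (2 * j + 1) - vtil m (2 * j) := by
  rw [vtil, if_neg (by omega), if_pos (by omega), show (4 * j + 3 + 1) / 2 = 2 * j + 2 by omega,
    show (4 * j + 3 - 1) / 2 = 2 * j + 1 by omega, show (4 * j + 3 - 3) / 2 = 2 * j by omega]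

theorem isExceptionalTriple_vtil (n : ℕ) (p : ℤ) (hp : 0 < n → Odd p) :
    IsExceptionalTriple (vtil n (p - 1)) (vtil n p) (vtil n (p + 1)) := by
  induction n generalizing p with
  | zero => constructor <;> simp only [vtil, chi] <;> push_cast <;> ring
  | succ m ih =>
    have hodd := hp m.succ_pos
    obtain ⟨j, rfl | rfl⟩ : ∃ j : ℤ, p = 4 * j + 1 ∨ p = 4 * j + 3 := by
      rw [Int.odd_iff] at hodd
      exact ⟨p / 4, by omega⟩
    all_goals
      have h := ih (2 * j + 1) fun _ => ⟨j, rfl⟩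
      rw [show 2 * j + 1 - 1 = 2 * j by ring, show 2 * j + 1 + 1 = 2 * j + 2 by ring] at h
    · rw [vtil_succ_four_mul_add_one, show 4 * j + 1 - 1 = 2 * (2 * j) by ring,
        show 4 * j + 1 + 1 = 2 * (2 * j + 1) by ring, vtil_succ_two_mul, vtil_succ_two_mul]
      exact h.mutate_left
    · rw [vtil_succ_four_mul_add_three, show 4 * j + 3 - 1 = 2 * (2 * j + 1) by ring,
        show 4 * j + 3 + 1 = 2 * (2 * j + 2) by ring, vtil_succ_two_mul, vtil_succ_two_mul]
      exact h.mutate_right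

/-- Key Euler-characteristic identities for the movable cone wall: with
`e_α = ṽ((p−1)/2ⁿ)`, `e_γ = ṽ(p/2ⁿ)`, `e_β = ṽ((p+1)/2ⁿ)` (`p` odd when `n > 0`),
`w = n₂·e_α − n₁·τ(e_β)` and `P = e_γ − (3·ch₀(e_β) − n₂)·e_α`:
`χ(e_γ, w) = 0`, `χ(e_β, P) = 0`, `χ(P, P) = 1 − n₂·(3·ch₀(e_β) − n₂)`, and
`χ(P, w − P) = −1`. -/
theorem movable_cone_wall_identities (n : ℕ) (p : ℤ) (hp : 0 < n → Odd p) (n₁ n₂ : ℝ)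
    (w P : ℝ × ℝ × ℝ)
    (hw : w = n₂ • vtil n (p - 1) - n₁ • tau (vtil n (p + 1)))
    (hP : P = vtil n p - (3 * (vtil n (p + 1)).1 - n₂) • vtil n (p - 1)) :
    chi (vtil n p) w = 0 ∧
    chi (vtil n (p + 1)) P = 0 ∧
    chi P P = 1 - n₂ * (3 * (vtil n (p + 1)).1 - n₂) ∧
    chi P (w - P) = -1 := by
  obtain ⟨aa, cc, bb, ca, bc, ba, ac, cb, ab⟩ := isExceptionalTriple_vtil n p hp
  subst hw hP
  refine ⟨?_, ?_, ?_, ?_⟩ <;>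
    simp only [chi_sub_left, chi_sub_right, chi_smul_left, chi_smul_right, chi_tau_right,
      aa, cc, ca, bc, ba, ac] <;> ring
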